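/- Let i be a nonnegative integer and let α, β, γ be complex numbers. Assume that (β)_{m+n} and (α−γ+1+i)_n are nonzero for all nonnegative integers m, n, that no argument of Γ appearing on the right-hand side below is a nonpositive integer, and that the double series defining the Kampé de Fériet function converges absolutely. Then F^{2:0;1}_{1:0;1}[α, γ : — ; α−β−γ+1+i ; β : — ; α−γ+1+i ; −1, 1] = (2^{i−2γ} · Γ(1+α−γ+i) · Γ(γ−i)) / (Γ(γ) · Γ(1+α−2γ+i)) · Σ_{r=0}^{i} (−1)^r · C(i,r) · Γ((α+i+r+1)/2−γ) / Γ((α−i+r+1)/2). -/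

import Mathlib

open Complex

noncomputable section

/-- Pochhammer symbol `(a)_n = a (a+1) ⋯ (a+n-1)`. -/
def poch (a : ℂ) (n : ℕ) : ℂ := ∏ k ∈ Finset.range n, (a + k)

/-- `z` is not a nonpositive integer. -/
def notNonposInt (z : ℂ) : Prop := ∀ n : ℕ, z ≠ -(n : ℂ)

/-- Term of the Kampé de Fériet double series `F^{2:0;1}_{1:0;1}`. -/
def kdfTerm (h₁ h₂ b₁ β d₁ x y : ℂ) (p : ℕ × ℕ) : ℂ :=
  poch h₁ (p.1 + p.2) * poch h₂ (p.1 + p.2) * poch b₁ p.2 /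
    (poch β (p.1 + p.2) * poch d₁ p.2) * x ^ p.1 * y ^ p.2 /
    ((p.1.factorial : ℂ) * (p.2.factorial : ℂ))

open Filter Topology

lemma poch_zero (a : ℂ) : poch a 0 = 1 := by simp [poch]

lemma poch_succ (a : ℂ) (n : ℕ) : poch a (n + 1) = poch a n * (a + n) := by
  simp [poch, Finset.prod_range_succ]

lemma poch_succ_left (a : ℂ) (n : ℕ) : poch a (n + 1) = a * poch (a + 1) n := by
  simp only [poch, Finset.prod_range_succ']
  rw [mul_comm]
  congr 1
  · simp
  · exact Finset.prod_congr rfl fun k _ => by push_cast; ring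

/-- The functional equation of the entire function `1 / Γ`. -/
lemma inv_Gamma_eq (z : ℂ) : (Gamma z)⁻¹ = z * (Gamma (z + 1))⁻¹ :=
  one_div_Gamma_eq_self_mul_one_div_Gamma_add_one z

lemma inv_Gamma_eq_poch_mul (z : ℂ) (n : ℕ) :
    (Gamma z)⁻¹ = poch z n * (Gamma (z + n))⁻¹ := by
  induction n with
  | zero => simp [poch_zero]
  | succ n ih =>
    rw [ih, poch_succ, inv_Gamma_eq (z + n)]
    push_cast
    ring_nf

/-- Term of the series `₂F₁(a, b; c; -1) / Γ(c)`, entire in `a`, `b` and `c`. -/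
def regTerm (a b c : ℂ) (n : ℕ) : ℂ :=
  (-1) ^ n * poch a n * poch b n * (Gamma (c + n))⁻¹ / (n.factorial : ℂ)

/-- The value `₂F₁(a, b; c; -1) / Γ(c)` of the regularized hypergeometric series. -/
def regHyp (a b c : ℂ) : ℂ := ∑' n, regTerm a b c n

lemma regTerm_zero (a b c : ℂ) : regTerm a b c 0 = (Gamma c)⁻¹ := by
  simp [regTerm, poch_zero]

lemma tsum_eq_zero_of_telescope {f H : ℕ → ℂ} (hf : Summable f) (h0 : f 0 = H 0)
    (hs : ∀ n, f (n + 1) = H (n + 1) - H n) (hH : Tendsto H atTop (𝓝 0)) : ∑' n, f n = 0 := by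
  have hsum : ∀ n, ∑ k ∈ Finset.range (n + 1), f k = H n := by
    intro n
    induction n with
    | zero => simpa using h0
    | succ n ih => rw [Finset.sum_range_succ, ih, hs]; ring
  have h1 := (tendsto_add_atTop_iff_nat 1).2 hf.hasSum.tendsto_sum_nat
  simp only [hsum] at h1
  exact tendsto_nhds_unique h1 hH

/-- A contiguous relation for `₂F₁` that is special to the argument `-1`. -/
lemma regHyp_contiguous (a b c : ℂ) (h₁ : Summable (regTerm a b c))
    (h₂ : Summable (regTerm (a - 1) (b - 1) (c - 1))) (h₃ : Summable (regTerm a (b - 1) c)) :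
    2 * (b - 1) * regHyp a b c =
      regHyp (a - 1) (b - 1) (c - 1) - (c - b) * regHyp a (b - 1) c := by
  have hs := ((h₁.mul_left (2 * (b - 1))).sub h₂).add (h₃.mul_left (c - b))
  have key := tsum_eq_zero_of_telescope (H := fun n => (b - 1) * regTerm a b c n) hs ?_ ?_ ?_
  · rw [((h₁.mul_left (2 * (b - 1))).sub h₂).tsum_add (h₃.mul_left (c - b)),
      (h₁.mul_left (2 * (b - 1))).tsum_sub h₂, tsum_mul_left, tsum_mul_left] at key
    unfold regHyp
    linear_combination key
  · simp only [regTerm_zero]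
    rw [inv_Gamma_eq (c - 1), sub_add_cancel]
    ring
  · intro n
    have e₁ : c - 1 + ((n + 1 : ℕ) : ℂ) = c + n := by push_cast; ring
    have e₂ : c + n + 1 = c + ((n + 1 : ℕ) : ℂ) := by push_cast; ring
    have hn : (n : ℂ) + 1 ≠ 0 := Nat.cast_add_one_ne_zero n
    have hf : (n.factorial : ℂ) ≠ 0 := by exact_mod_cast n.factorial_ne_zero
    simp only [regTerm]
    rw [e₁, inv_Gamma_eq (c + n), e₂, poch_succ_left (a - 1), poch_succ_left (b - 1),
      sub_add_cancel, sub_add_cancel, poch_succ, poch_succ, Nat.factorial_succ]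
    generalize (Gamma (c + ((n + 1 : ℕ) : ℂ)))⁻¹ = q
    push_cast
    field_simp
    ring
  · simpa using h₁.tendsto_atTop_zero.const_mul (b - 1)

lemma regHyp_kummer_shift (a b : ℂ) (h₁ : Summable (regTerm a b (1 + a - b)))
    (h₂ : Summable (regTerm a (b - 1) (2 + a - b)))
    (h₃ : Tendsto (fun n => a * regTerm (a + 1) b (2 + a - b) n) atTop (𝓝 0)) :
    regHyp a b (1 + a - b) = (1 + a / 2 - b) * regHyp a (b - 1) (2 + a - b) := by
  have hs := h₁.sub (h₂.mul_left (1 + a / 2 - b))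
  have key := tsum_eq_zero_of_telescope
    (H := fun n => 1 / 2 * (a * regTerm (a + 1) b (2 + a - b) n)) hs ?_ ?_ ?_
  · rw [h₁.tsum_sub (h₂.mul_left (1 + a / 2 - b)), tsum_mul_left] at key
    unfold regHyp
    linear_combination key
  · simp only [regTerm_zero]
    rw [inv_Gamma_eq (1 + a - b), show 1 + a - b + 1 = 2 + a - b by ring]
    ring
  · intro n
    have e₁ : 1 + a - b + ((n + 1 : ℕ) : ℂ) = 2 + a - b + n := by push_cast; ring
    have e₂ : 2 + a - b + n + 1 = 2 + a - b + ((n + 1 : ℕ) : ℂ) := by push_cast; ring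
    have hn : (n : ℂ) + 1 ≠ 0 := Nat.cast_add_one_ne_zero n
    have hf : (n.factorial : ℂ) ≠ 0 := by exact_mod_cast n.factorial_ne_zero
    simp only [regTerm]
    rw [e₁, inv_Gamma_eq (2 + a - b + n), e₂, poch_succ_left (b - 1), poch_succ_left a,
      sub_add_cancel, poch_succ, poch_succ, Nat.factorial_succ]
    generalize (Gamma (2 + a - b + ((n + 1 : ℕ) : ℂ)))⁻¹ = q
    push_cast
    field_simp
    ring
  · simpa only [mul_zero] using h₃.const_mul (1 / 2)

lemma regHyp_kummer_shift_two (a b : ℂ) (h₁ : Summable (regTerm a b (1 + a - b)))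
    (h₂ : Summable (regTerm (a + 2) (b + 1) (2 + a - b)))
    (h₃ : Summable (regTerm (a + 1) (b + 1) (2 + a - b))) :
    regHyp a b (1 + a - b) = 2 * (1 + a) * regHyp (a + 2) (b + 1) (2 + a - b) := by
  have hs := h₁.sub (h₂.mul_left (2 * (1 + a)))
  have key := tsum_eq_zero_of_telescope
    (H := fun n => -((1 + a) * regTerm (a + 2) (b + 1) (2 + a - b) n +
      b * regTerm (a + 1) (b + 1) (2 + a - b) n)) hs ?_ ?_ ?_
  · rw [h₁.tsum_sub (h₂.mul_left (2 * (1 + a))), tsum_mul_left] at key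
    unfold regHyp
    linear_combination key
  · simp only [regTerm_zero]
    rw [inv_Gamma_eq (1 + a - b), show 1 + a - b + 1 = 2 + a - b by ring]
    ring
  · intro n
    have e₁ : 1 + a - b + ((n + 1 : ℕ) : ℂ) = 2 + a - b + n := by push_cast; ring
    have e₂ : 2 + a - b + n + 1 = 2 + a - b + ((n + 1 : ℕ) : ℂ) := by push_cast; ring
    have hn : (n : ℂ) + 1 ≠ 0 := Nat.cast_add_one_ne_zero n
    have hf : (n.factorial : ℂ) ≠ 0 := by exact_mod_cast n.factorial_ne_zero
    have hp : (1 + a) * poch (a + 2) n = poch (a + 1) n * (a + 1 + n) := by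
      rw [← poch_succ, poch_succ_left, show a + 1 + 1 = a + 2 by ring]; ring
    simp only [regTerm]
    rw [e₁, inv_Gamma_eq (2 + a - b + n), e₂, poch_succ_left b, poch_succ_left a,
      poch_succ, poch_succ, poch_succ, Nat.factorial_succ]
    generalize (Gamma (2 + a - b + ((n + 1 : ℕ) : ℂ)))⁻¹ = q
    generalize poch (a + 2) n = X at *
    generalize poch (a + 1) n = Y at *
    generalize poch (b + 1) n = Z at *
    push_cast
    field_simp
    linear_combination (-1) ^ n * Z * q * b * (a + 3 + 2 * n) * hp
  · simpa using (((h₂.mul_left (1 + a)).add (h₃.mul_left b)).tendsto_atTop_zero).neg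

lemma tendsto_inv_Gamma_add_nat_mul (z : ℂ) :
    Tendsto (fun n : ℕ => (Gamma (z + n + 1))⁻¹ * n.factorial * (n : ℂ) ^ z) atTop (𝓝 1) := by
  obtain ⟨M, hM⟩ := exists_nat_gt (-z.re)
  induction M generalizing z with
  | zero =>
    have hz : Gamma z ≠ 0 := Gamma_ne_zero_of_re_pos (by simpa using hM)
    have h := (GammaSeq_tendsto_Gamma z).const_mul (Gamma z)⁻¹
    rw [inv_mul_cancel₀ hz] at h
    refine h.congr fun n => ?_
    have h1 := inv_Gamma_eq_poch_mul z (n + 1)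
    have hp : poch z (n + 1) ≠ 0 := fun h0 => by
      rw [h0, zero_mul] at h1
      exact inv_ne_zero hz h1
    rw [h1, GammaSeq]
    change poch z (n + 1) * (Gamma (z + ((n + 1 : ℕ) : ℂ)))⁻¹ *
      ((n : ℂ) ^ z * n.factorial / poch z (n + 1)) = _
    push_cast
    rw [← add_assoc]
    field_simp
  | succ M ih =>
    have h := ih (z + 1) (by push_cast at hM; simp; linarith)
    have h2 := (tendsto_natCast_div_add_atTop (z + 1)).inv₀ one_ne_zero
    have h3 := h.mul h2
    simp only [inv_one, mul_one] at h3
    refine h3.congr' ?_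
    filter_upwards [eventually_ne_atTop 0] with n hn
    have hn' : (n : ℂ) ≠ 0 := Nat.cast_ne_zero.2 hn
    rw [inv_Gamma_eq (z + n + 1), show z + 1 + n + 1 = z + n + 1 + 1 by ring,
      cpow_add _ _ hn', cpow_one, inv_div]
    field_simp
    ring

lemma tendsto_poch_div (z : ℂ) :
    Tendsto (fun n : ℕ => poch z (n + 1) / (n.factorial * (n : ℂ) ^ z)) atTop
      (𝓝 (Gamma z)⁻¹) := by
  have hB := tendsto_inv_Gamma_add_nat_mul z
  have h := (hB.inv₀ one_ne_zero).const_mul (Gamma z)⁻¹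
  rw [inv_one, mul_one] at h
  refine h.congr' ?_
  filter_upwards [hB.eventually_ne one_ne_zero] with n hn
  have h1 := inv_Gamma_eq_poch_mul z (n + 1)
  push_cast at h1
  rw [← add_assoc] at h1
  rw [h1]
  generalize (Gamma (z + n + 1))⁻¹ = q at *
  have hq : q ≠ 0 := fun h0 => hn (by simp [h0])
  have hp : (n : ℂ) ^ z ≠ 0 := fun h0 => hn (by simp [h0])
  have hf : (n.factorial : ℂ) ≠ 0 := by exact_mod_cast n.factorial_ne_zero
  field_simp

lemma tendsto_regTerm_mul_cpow (a b c : ℂ) :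
    Tendsto (fun n : ℕ => (-1) ^ (n + 1) * regTerm a b c (n + 1) * (n : ℂ) ^ (c - a - b + 1))
      atTop (𝓝 ((Gamma a)⁻¹ * (Gamma b)⁻¹)) := by
  have h := (((tendsto_poch_div a).mul (tendsto_poch_div b)).mul
    (tendsto_inv_Gamma_add_nat_mul c)).mul (tendsto_natCast_div_add_atTop (1 : ℂ))
  simp only [mul_one] at h
  refine h.congr' ?_
  filter_upwards [eventually_ne_atTop 0] with n hn
  have hn' : (n : ℂ) ≠ 0 := Nat.cast_ne_zero.2 hn
  have hn1 : (n : ℂ) + 1 ≠ 0 := Nat.cast_add_one_ne_zero n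
  have hf : (n.factorial : ℂ) ≠ 0 := by exact_mod_cast n.factorial_ne_zero
  have ha : (n : ℂ) ^ a ≠ 0 := (cpow_ne_zero_iff).2 (Or.inl hn')
  have hb : (n : ℂ) ^ b ≠ 0 := (cpow_ne_zero_iff).2 (Or.inl hn')
  have hs : ((-1 : ℂ) ^ (n + 1)) * (-1) ^ (n + 1) = 1 := by
    rw [← mul_pow]; simp
  rw [cpow_add _ _ hn', cpow_sub _ _ hn', cpow_sub _ _ hn', cpow_one, regTerm,
    Nat.factorial_succ]
  push_cast
  rw [← add_assoc]
  generalize (Gamma (c + n + 1))⁻¹ = q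
  generalize (-1 : ℂ) ^ (n + 1) = e at *
  field_simp
  linear_combination (-poch a (n + 1) * poch b (n + 1) * q * (n : ℂ) ^ c) * hs

lemma tendsto_norm_regTerm_mul_rpow (a b c : ℂ) :
    Tendsto (fun n : ℕ => ‖regTerm a b c (n + 1)‖ * (n : ℝ) ^ ((c - a - b).re + 1))
      atTop (𝓝 ‖(Gamma a)⁻¹ * (Gamma b)⁻¹‖) := by
  refine (tendsto_regTerm_mul_cpow a b c).norm.congr' ?_
  filter_upwards [eventually_gt_atTop 0] with n hn
  rw [norm_mul, norm_mul, norm_natCast_cpow_of_pos hn]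
  simp

lemma summable_regTerm {a b c : ℂ} (h : 0 < (c - a - b).re) : Summable (regTerm a b c) := by
  rw [← summable_nat_add_iff 1]
  have hg : Summable fun n : ℕ => (n : ℝ) ^ (-((c - a - b).re + 1)) :=
    Real.summable_nat_rpow.2 (by linarith)
  refine summable_of_isBigO_nat hg ?_
  refine Asymptotics.IsBigO.of_bound (‖(Gamma a)⁻¹ * (Gamma b)⁻¹‖ + 1) ?_
  filter_upwards [(tendsto_norm_regTerm_mul_rpow a b c).eventually_le_const (lt_add_one _),
    eventually_gt_atTop 0] with n hn h0
  have hpos : 0 < (n : ℝ) ^ ((c - a - b).re + 1) := Real.rpow_pos_of_pos (by exact_mod_cast h0) _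
  rw [Real.rpow_neg (Nat.cast_nonneg n), norm_inv, Real.norm_of_nonneg hpos.le,
    ← div_eq_mul_inv, le_div_iff₀ hpos]
  exact hn

lemma re_pos_of_summable_norm_regTerm {a b c : ℂ} (ha : notNonposInt a) (hb : notNonposInt b)
    (h : Summable fun n => ‖regTerm a b c n‖) : 0 < (c - a - b).re := by
  have hL : 0 < ‖(Gamma a)⁻¹ * (Gamma b)⁻¹‖ :=
    norm_pos_iff.2 (mul_ne_zero (inv_ne_zero (Gamma_ne_zero ha)) (inv_ne_zero (Gamma_ne_zero hb)))
  have hg : Summable fun n : ℕ => (n : ℝ) ^ (-((c - a - b).re + 1)) := by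
    refine summable_of_isBigO_nat (g := fun n => ‖regTerm a b c (n + 1)‖)
      ((summable_nat_add_iff (f := fun n => ‖regTerm a b c n‖) 1).2 h) ?_
    refine Asymptotics.IsBigO.of_bound (‖(Gamma a)⁻¹ * (Gamma b)⁻¹‖ / 2)⁻¹ ?_
    filter_upwards [(tendsto_norm_regTerm_mul_rpow a b c).eventually_const_le (half_lt_self hL),
      eventually_gt_atTop 0] with n hn h0
    have hpos : 0 < (n : ℝ) ^ ((c - a - b).re + 1) :=
      Real.rpow_pos_of_pos (by exact_mod_cast h0) _
    rw [Real.rpow_neg (Nat.cast_nonneg n), norm_inv, Real.norm_of_nonneg hpos.le, norm_norm,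
      ← div_eq_inv_mul, le_div_iff₀ (half_pos hL), ← div_eq_inv_mul, div_le_iff₀ hpos]
    exact hn
  have := Real.summable_nat_rpow.1 hg
  linarith

lemma poch_neg_nat {k n : ℕ} (h : k < n) : poch (-(k : ℂ)) n = 0 :=
  Finset.prod_eq_zero (Finset.mem_range.2 h) (by simp)

lemma regTerm_neg_nat {k n : ℕ} (h : k < n) (b c : ℂ) : regTerm (-(k : ℂ)) b c n = 0 := by
  simp [regTerm, poch_neg_nat h]

lemma summable_regTerm_neg_nat (k : ℕ) (b c : ℂ) : Summable (regTerm (-(k : ℂ)) b c) :=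
  summable_of_ne_finset_zero (s := Finset.range (k + 1)) fun _ hn =>
    regTerm_neg_nat (Nat.lt_of_succ_le (not_lt.1 (Finset.mem_range.not.1 hn))) b c

lemma inv_Gamma_two_mul (z : ℂ) :
    (Gamma (2 * z))⁻¹ = 2 ^ (1 - 2 * z) * (√Real.pi : ℂ) * (Gamma z)⁻¹ * (Gamma (z + 1 / 2))⁻¹ := by
  have h := Gamma_mul_Gamma_add_half z
  have h2 : (2 : ℂ) ^ (1 - 2 * z) ≠ 0 := (cpow_ne_zero_iff).2 (Or.inl two_ne_zero)
  have hpi : (√Real.pi : ℂ) ≠ 0 := by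
    exact_mod_cast (Real.sqrt_pos.2 Real.pi_pos).ne'
  have h' := congrArg (·⁻¹) h
  simp only [mul_inv] at h'
  rw [mul_assoc _ (Gamma z)⁻¹, h']
  field_simp

lemma regTerm_one_one (b : ℂ) (n : ℕ) :
    regTerm 1 b 1 n = (-1) ^ n * poch b n / (n.factorial : ℂ) := by
  have h := inv_Gamma_eq_poch_mul 1 n
  rw [Gamma_one, inv_one] at h
  rw [regTerm]
  linear_combination -((-1) ^ n * poch b n / (n.factorial : ℂ)) * h

lemma regTerm_mul_Gamma {A b : ℂ} (h : 0 < (1 + A - b).re) (n : ℕ) :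
    regTerm A b (1 + A - b) n * Gamma (1 + A - b) =
      (poch A n / poch (1 + A - b) n) * regTerm 1 b 1 n := by
  have hG : Gamma (1 + A - b) ≠ 0 := Gamma_ne_zero_of_re_pos h
  have h1 := inv_Gamma_eq_poch_mul (1 + A - b) n
  have h2 : (Gamma (1 + A - b + n))⁻¹ * Gamma (1 + A - b) = (poch (1 + A - b) n)⁻¹ := by
    refine eq_inv_of_mul_eq_one_left ?_
    rw [mul_right_comm, mul_comm _ (poch _ _), ← h1, inv_mul_cancel₀ hG]
  rw [regTerm_one_one, regTerm, div_eq_mul_inv (poch A n), ← h2]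
  ring

lemma norm_poch_le {A w : ℂ} (hw : 0 ≤ w.re)
    (h : 0 ≤ A.re * w.re + A.im * w.im) (n : ℕ) : ‖poch A n‖ ≤ ‖poch (A + w) n‖ := by
  simp only [poch, norm_prod]
  refine Finset.prod_le_prod (fun _ _ => norm_nonneg _) fun j _ => ?_
  rw [← sq_le_sq₀ (norm_nonneg _) (norm_nonneg _), ← normSq_eq_norm_sq, ← normSq_eq_norm_sq,
    normSq_apply, normSq_apply]
  have hj : (0 : ℝ) ≤ j * w.re := mul_nonneg (Nat.cast_nonneg j) hw
  simp only [add_re, add_im, natCast_re, natCast_im]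
  nlinarith [sq_nonneg w.re, sq_nonneg w.im]

lemma tendsto_regHyp_mul_Gamma (a : ℂ) {b : ℂ} (hb : b.re < 0) :
    Tendsto (fun k : ℕ => regHyp (a + 2 * k) b (1 + (a + 2 * k) - b) *
      Gamma (1 + (a + 2 * k) - b)) atTop (𝓝 (regHyp 1 b 1)) := by
  have hlarge : ∀ᶠ k : ℕ in atTop, 0 ≤ (a + 2 * (k : ℂ)).re ∧
      0 ≤ (a + 2 * (k : ℂ)).re * (1 - b).re + (a + 2 * (k : ℂ)).im * (1 - b).im := by
    have hw : 0 < (1 - b).re := by simp; linarith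
    have h1 : Tendsto (fun k : ℕ => (a + 2 * (k : ℂ)).re) atTop atTop := by
      simp only [add_re, mul_re, re_ofNat, natCast_re, im_ofNat, natCast_im, mul_zero, sub_zero]
      exact tendsto_atTop_add_const_left _ _
        (tendsto_natCast_atTop_atTop.const_mul_atTop two_pos)
    have h2 := h1.atTop_mul_const hw
    filter_upwards [h1.eventually_ge_atTop 0, h2.eventually_ge_atTop (-(a.im * (1 - b).im))]
      with k hk hk'
    refine ⟨hk, ?_⟩
    have : (a + 2 * (k : ℂ)).im = a.im := by simp
    rw [this]
    linarith
  have hpos : ∀ᶠ k : ℕ in atTop, 0 < (1 + (a + 2 * (k : ℂ)) - b).re := by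
    filter_upwards [hlarge] with k hk
    have := hk.1
    simp only [add_re, sub_re, one_re] at this ⊢
    linarith
  have hT : Tendsto (fun k : ℕ => ∑' n, (poch (a + 2 * k) n / poch (1 + (a + 2 * k) - b) n) *
      regTerm 1 b 1 n) atTop (𝓝 (regHyp 1 b 1)) := by
    refine tendsto_tsum_of_dominated_convergence (bound := fun n => ‖regTerm 1 b 1 n‖)
      (summable_regTerm (by simpa using hb)).norm (fun n => ?_) ?_
    · have h1 : Tendsto (fun k : ℕ => poch (a + 2 * k) n / poch (1 + (a + 2 * k) - b) n)
          atTop (𝓝 (∏ _j ∈ Finset.range n, (1 : ℂ))) := by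
        simp only [poch, ← Finset.prod_div_distrib]
        refine tendsto_finsetProd _ fun j _ => ?_
        have := tendsto_add_mul_div_add_mul_atTop_nhds (a + j) (1 + a - b + j) 2
          (two_ne_zero (α := ℂ))
        rw [div_self two_ne_zero] at this
        refine this.congr fun k => ?_
        congr 1 <;> ring
      simpa using h1.mul_const (regTerm 1 b 1 n)
    · filter_upwards [hlarge] with k hk n
      rw [norm_mul, norm_div]
      refine mul_le_of_le_one_left (norm_nonneg _) (div_le_one_of_le₀ ?_ (norm_nonneg _))
      rw [show 1 + (a + 2 * (k : ℂ)) - b = a + 2 * (k : ℂ) + (1 - b) by ring]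
      exact norm_poch_le (by simp; linarith) hk.2 n
  refine hT.congr' ?_
  filter_upwards [hpos] with k hk
  rw [regHyp, ← tsum_mul_right]
  exact tsum_congr fun n => (regTerm_mul_Gamma hk n).symm

lemma regHyp_kummer_shift_left (a : ℂ) {b : ℂ} (hb : b.re < 0) :
    regHyp a b (1 + a - b) = (1 + a) * (2 + a - 2 * b) * regHyp (a + 2) b (1 + (a + 2) - b) := by
  have h := regHyp_kummer_shift_two a (b - 1)
    (summable_regTerm (by simp; linarith)) (summable_regTerm (by simp; linarith))
    (summable_regTerm (by simp; linarith))
  rw [show 1 + a - (b - 1) = 2 + a - b by ring, sub_add_cancel,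
    show 2 + a - (b - 1) = 1 + (a + 2) - b by ring] at h
  rw [regHyp_kummer_shift a b (summable_regTerm (by simp; linarith))
    (summable_regTerm (by simp; linarith)), h]
  · ring
  · simpa using (summable_regTerm (a := a + 1) (b := b) (c := 2 + a - b)
      (by simp; linarith)).tendsto_atTop_zero.const_mul a

lemma regHyp_kummer_iterate (a : ℂ) {b : ℂ} (hb : b.re < 0) (k : ℕ) :
    regHyp a b (1 + a - b) = 4 ^ k * poch ((1 + a) / 2) k * poch (1 + a / 2 - b) k *
      regHyp (a + 2 * k) b (1 + (a + 2 * k) - b) := by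
  induction k with
  | zero => simp [poch_zero]
  | succ k ih =>
    rw [ih, regHyp_kummer_shift_left (a + 2 * k) hb, poch_succ, poch_succ, pow_succ]
    push_cast
    rw [show a + 2 * ((k : ℂ) + 1) = a + 2 * k + 2 by ring]
    ring

lemma tendsto_kummer_coeff (a b : ℂ) :
    Tendsto (fun n : ℕ => 4 ^ (n + 1) * poch ((1 + a) / 2) (n + 1) *
      poch (1 + a / 2 - b) (n + 1) * (Gamma (1 + (a + 2 * ((n + 1 : ℕ) : ℂ)) - b))⁻¹) atTop
      (𝓝 (2 ^ (b - a) * (√Real.pi : ℂ) * (Gamma ((1 + a) / 2))⁻¹ * (Gamma (1 + a / 2 - b))⁻¹)) := by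
  have h := ((((tendsto_poch_div ((1 + a) / 2)).mul (tendsto_poch_div (1 + a / 2 - b))).mul
    (tendsto_inv_Gamma_add_nat_mul ((1 + a - b) / 2))).mul
    (tendsto_inv_Gamma_add_nat_mul ((1 + a - b) / 2 + 1 / 2))).const_mul
      ((2 : ℂ) ^ (b - a) * (√Real.pi : ℂ))
  simp only [mul_one, ← mul_assoc] at h
  refine h.congr' ?_
  filter_upwards [eventually_ne_atTop 0] with n hn
  have hn' : (n : ℂ) ≠ 0 := Nat.cast_ne_zero.2 hn
  have hf : (n.factorial : ℂ) ≠ 0 := by exact_mod_cast n.factorial_ne_zero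
  have hpow : ∀ z : ℂ, (n : ℂ) ^ z ≠ 0 := fun z => (cpow_ne_zero_iff).2 (Or.inl hn')
  have hx : (n : ℂ) ^ ((1 + a - b) / 2) * (n : ℂ) ^ ((1 + a - b) / 2 + 1 / 2) =
      (n : ℂ) ^ ((1 + a) / 2) * (n : ℂ) ^ (1 + a / 2 - b) := by
    rw [← cpow_add _ _ hn', ← cpow_add _ _ hn']
    ring_nf
  have h4 : (4 : ℂ) ^ (n + 1) * 2 ^ (1 - 2 * ((1 + a - b) / 2 + n + 1)) = 2 ^ (b - a) := by
    rw [show (4 : ℂ) = 2 ^ 2 by norm_num, ← pow_mul, ← cpow_natCast,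
      ← cpow_add _ _ two_ne_zero]
    push_cast
    ring_nf
  rw [show 1 + (a + 2 * ((n + 1 : ℕ) : ℂ)) - b = 2 * ((1 + a - b) / 2 + n + 1) by push_cast; ring,
    inv_Gamma_two_mul, ← h4,
    show (1 + a - b) / 2 + n + 1 + 1 / 2 = (1 + a - b) / 2 + 1 / 2 + n + 1 by ring]
  have h1 := hpow ((1 + a) / 2)
  have h2 := hpow (1 + a / 2 - b)
  generalize (Gamma ((1 + a - b) / 2 + n + 1))⁻¹ = q₁
  generalize (Gamma ((1 + a - b) / 2 + 1 / 2 + n + 1))⁻¹ = q₂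
  generalize (2 : ℂ) ^ (1 - 2 * ((1 + a - b) / 2 + n + 1)) = t
  generalize (n : ℂ) ^ ((1 + a) / 2) = u₁ at *
  generalize (n : ℂ) ^ (1 + a / 2 - b) = u₂ at *
  generalize (n : ℂ) ^ ((1 + a - b) / 2) = v₁ at *
  generalize (n : ℂ) ^ ((1 + a - b) / 2 + 1 / 2) = v₂ at *
  generalize poch ((1 + a) / 2) (n + 1) = P₁
  generalize poch (1 + a / 2 - b) (n + 1) = P₂
  field_simp
  linear_combination P₁ * P₂ * q₁ * q₂ * t * hx

lemma regHyp_kummer_aux (a : ℂ) {b : ℂ} (hb : b.re < 0) :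
    regHyp a b (1 + a - b) = 2 ^ (b - a) * (√Real.pi : ℂ) * (Gamma ((1 + a) / 2))⁻¹ *
      (Gamma (1 + a / 2 - b))⁻¹ * regHyp 1 b 1 := by
  have h := (tendsto_kummer_coeff a b).mul
    ((tendsto_add_atTop_iff_nat 1).2 (tendsto_regHyp_mul_Gamma a hb))
  refine tendsto_nhds_unique (tendsto_const_nhds.congr' ?_) h
  have hlarge : Tendsto (fun n : ℕ => (1 + (a + 2 * ((n + 1 : ℕ) : ℂ)) - b).re) atTop atTop := by
    have : ∀ n : ℕ, (1 + (a + 2 * ((n + 1 : ℕ) : ℂ)) - b).re = (3 + a.re - b.re) + 2 * n := by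
      intro n
      push_cast
      simp
      ring
    simp only [this]
    exact tendsto_atTop_add_const_left _ _
      (tendsto_natCast_atTop_atTop.const_mul_atTop two_pos)
  filter_upwards [hlarge.eventually_gt_atTop 0] with n hn
  have hG := Gamma_ne_zero_of_re_pos hn
  rw [regHyp_kummer_iterate a hb (n + 1)]
  field_simp

lemma regHyp_one_one {b : ℂ} (hb : b.re < 0) : regHyp 1 b 1 = 2 ^ (-b) := by
  have h := regHyp_kummer_aux 0 hb
  have h0 : regHyp 0 b (1 + 0 - b) = (Gamma (1 - b))⁻¹ := by
    rw [regHyp, tsum_eq_single 0]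
    · rw [regTerm_zero]; simp
    · intro n hn
      have := regTerm_neg_nat (Nat.pos_of_ne_zero hn) b (1 + 0 - b)
      simpa using this
  have hG : Gamma (1 - b) ≠ 0 := Gamma_ne_zero_of_re_pos (by simp; linarith)
  have hh := Gamma_mul_Gamma_add_half (1 / 2)
  norm_num at hh
  have hpi : (√Real.pi : ℂ) ≠ 0 := by
    exact_mod_cast (Real.sqrt_pos.2 Real.pi_pos).ne'
  rw [h0] at h
  simp only [zero_div, add_zero, sub_zero] at h
  rw [hh] at h
  rw [cpow_neg]
  have h2 : (2 : ℂ) ^ b ≠ 0 := (cpow_ne_zero_iff).2 (Or.inl two_ne_zero)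
  field_simp at h ⊢
  linear_combination -h

/-- The Kummer summation theorem for `₂F₁(a, b; 1 + a - b; -1)`, in regularized form. -/
theorem regHyp_kummer (a b : ℂ) (h : b.re < 1 / 2 ∨ ∃ k : ℕ, a = -k) :
    regHyp a b (1 + a - b) =
      2 ^ (-a) * (√Real.pi : ℂ) * (Gamma ((1 + a) / 2))⁻¹ * (Gamma (1 + a / 2 - b))⁻¹ := by
  obtain ⟨m, hm⟩ := exists_nat_gt b.re
  induction m generalizing b with
  | zero =>
    have hb : b.re < 0 := by simpa using hm
    rw [regHyp_kummer_aux a hb, regHyp_one_one hb, show -a = (b - a) + -b by ring,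
      cpow_add _ _ two_ne_zero]
    ring
  | succ m ih =>
    have h' : (b - 1).re < 1 / 2 ∨ ∃ k : ℕ, a = -k :=
      h.imp_left fun h => by simp only [sub_re, one_re]; linarith
    have := ih (b - 1) h' (by push_cast at hm; simp only [sub_re, one_re]; linarith)
    rw [show 1 + a - (b - 1) = 2 + a - b by ring,
      show 1 + a / 2 - (b - 1) = 1 + a / 2 - b + 1 by ring] at this
    rw [regHyp_kummer_shift a b, this, inv_Gamma_eq (1 + a / 2 - b)]
    · ring
    · rcases h with h | ⟨k, rfl⟩
      · exact summable_regTerm (by simp; linarith)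
      · exact summable_regTerm_neg_nat _ _ _
    · rcases h with h | ⟨k, rfl⟩
      · exact summable_regTerm (by simp; linarith)
      · exact summable_regTerm_neg_nat _ _ _
    · rcases h with h | ⟨k, rfl⟩
      · simpa using (summable_regTerm (a := a + 1) (b := b) (c := 2 + a - b)
          (by simp; linarith)).tendsto_atTop_zero.const_mul a
      · refine tendsto_const_nhds.congr' ?_
        filter_upwards [eventually_ge_atTop k] with n hn
        have := poch_neg_nat (Nat.lt_succ_of_le hn)
        rw [poch_succ_left] at this
        rw [regTerm]
        linear_combination (-((-1) ^ n * poch b n * (Gamma (2 + -(k : ℂ) - b + n))⁻¹ /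
          (n.factorial : ℂ))) * this

lemma sum_neg_one_pow_choose_succ (i : ℕ) (g : ℕ → ℂ) :
    ∑ r ∈ Finset.range (i + 1 + 1), (-1 : ℂ) ^ r * ((i + 1).choose r : ℂ) * g r =
      ∑ r ∈ Finset.range (i + 1), (-1 : ℂ) ^ r * (i.choose r : ℂ) * g r -
        ∑ r ∈ Finset.range (i + 1), (-1 : ℂ) ^ r * (i.choose r : ℂ) * g (r + 1) := by
  have h1 : ∑ r ∈ Finset.range (i + 1), (-1 : ℂ) ^ r * (i.choose r : ℂ) * g r =
      ∑ r ∈ Finset.range (i + 1 + 1), (-1 : ℂ) ^ r * (i.choose r : ℂ) * g r := by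
    rw [Finset.sum_range_succ _ (i + 1)]
    simp
  rw [h1, Finset.sum_range_succ' _ (i + 1), Finset.sum_range_succ' _ (i + 1), add_sub_right_comm,
    ← Finset.sum_sub_distrib]
  congr 1
  · refine Finset.sum_congr rfl fun r _ => ?_
    rw [Nat.choose_succ_succ]
    push_cast
    ring
  · simp

/-- The generalized Kummer theorem for `₂F₁(a, b; 1 + a - b + i; -1)`, in regularized form. -/
theorem poch_mul_regHyp_eq (i : ℕ) (a b : ℂ)
    (h : 0 < (1 + i - 2 * b).re ∨ i = 0 ∧ ∃ k : ℕ, a = -k)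
    (hq : notNonposInt (1 + a - 2 * b + i)) :
    poch (b - i) i * regHyp a b (1 + a - b + i) =
      2 ^ ((i : ℂ) - 2 * b) * (Gamma (1 + a - 2 * b + i))⁻¹ *
        ∑ r ∈ Finset.range (i + 1), (-1 : ℂ) ^ r * (i.choose r : ℂ) *
          (Gamma ((a + i + r + 1) / 2 - b) / Gamma ((a - i + r + 1) / 2)) := by
  induction i generalizing a b with
  | zero =>
    have h' : b.re < 1 / 2 ∨ ∃ k : ℕ, a = -k := by
      refine h.imp (fun h => ?_) (fun h => h.2)
      simp at h
      linarith
    have hG : Gamma ((1 + a) / 2 - b) ≠ 0 := by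
      refine Gamma_ne_zero fun n hn => hq (2 * n) ?_
      push_cast
      linear_combination 2 * hn
    simp only [CharP.cast_eq_zero, add_zero, zero_add, Finset.range_one, Finset.sum_singleton,
      pow_zero, Nat.choose_self, Nat.cast_one, sub_zero, poch_zero, one_mul, zero_sub]
    rw [regHyp_kummer a b h', show 1 + a - 2 * b = 2 * ((1 + a) / 2 - b) by ring,
      inv_Gamma_two_mul, show (1 + a) / 2 - b + 1 / 2 = 1 + a / 2 - b by ring,
      show -a = -(2 * b) + (1 - 2 * ((1 + a) / 2 - b)) by ring, cpow_add _ _ two_ne_zero,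
      add_comm a 1]
    generalize Gamma ((1 + a) / 2 - b) = G at *
    field_simp
  | succ i ih =>
    have hre : 0 < (1 + ((i + 1 : ℕ) : ℂ) - 2 * b).re := h.resolve_right (by simp)
    push_cast at hre hq ⊢
    have hre' : 0 < 2 + (i : ℝ) - 2 * b.re := by
      simp at hre
      linarith
    have e₁ : 1 + a - b + ((i : ℂ) + 1) - 1 = 1 + (a - 1) - (b - 1) + i := by ring
    have e₂ : 1 + a - b + ((i : ℂ) + 1) = 1 + a - (b - 1) + i := by ring
    have hc := regHyp_contiguous a b (1 + a - b + ((i : ℂ) + 1))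
      (summable_regTerm (by simp; linarith)) (summable_regTerm (by simp; linarith))
      (summable_regTerm (by simp; linarith))
    have ih₁ := ih (a - 1) (b - 1) (Or.inl (by simp; linarith)) (by convert! hq using 1; ring)
    have ih₂ := ih a (b - 1) (Or.inl (by simp; linarith)) (fun n hn => hq (n + 1) (by
      push_cast
      linear_combination hn))
    have hp : poch (b - ((i : ℂ) + 1)) (i + 1) = poch (b - 1 - i) i * (b - 1) := by
      rw [poch_succ, show b - ((i : ℂ) + 1) = b - 1 - i by ring, sub_add_cancel]
    have hQ := inv_Gamma_eq (1 + a - 2 * b + ((i : ℂ) + 1))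
    rw [sum_neg_one_pow_choose_succ]
    rw [← e₁, show 1 + (a - 1) - 2 * (b - 1) + (i : ℂ) = 1 + a - 2 * b + (i + 1) by ring,
      show (i : ℂ) - 2 * (b - 1) = (i + 1 - 2 * b) + 1 by ring, cpow_add _ _ two_ne_zero,
      cpow_one] at ih₁
    rw [← e₂, show 1 + a - 2 * (b - 1) + (i : ℂ) = 1 + a - 2 * b + (i + 1) + 1 by ring,
      show (i : ℂ) - 2 * (b - 1) = (i + 1 - 2 * b) + 1 by ring, cpow_add _ _ two_ne_zero,
      cpow_one] at ih₂
    have s₁ : ∑ r ∈ Finset.range (i + 1), (-1 : ℂ) ^ r * (i.choose r : ℂ) *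
        (Gamma ((a - 1 + i + r + 1) / 2 - (b - 1)) / Gamma ((a - 1 - i + r + 1) / 2)) =
        ∑ r ∈ Finset.range (i + 1), (-1 : ℂ) ^ r * (i.choose r : ℂ) *
        (Gamma ((a + (i + 1) + r + 1) / 2 - b) / Gamma ((a - (i + 1) + r + 1) / 2)) := by
      refine Finset.sum_congr rfl fun r _ => ?_
      rw [show (a - 1 + i + r + 1) / 2 - (b - 1) = (a + (i + 1) + r + 1) / 2 - b by ring,
        show (a - 1 - i + r + 1) / 2 = (a - (i + 1) + r + 1) / 2 by ring]
    have s₂ : ∑ r ∈ Finset.range (i + 1), (-1 : ℂ) ^ r * (i.choose r : ℂ) *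
        (Gamma ((a + i + r + 1) / 2 - (b - 1)) / Gamma ((a - i + r + 1) / 2)) =
        ∑ r ∈ Finset.range (i + 1), (-1 : ℂ) ^ r * (i.choose r : ℂ) *
        (Gamma ((a + (i + 1) + ((r + 1 : ℕ) : ℂ) + 1) / 2 - b) /
          Gamma ((a - (i + 1) + ((r + 1 : ℕ) : ℂ) + 1) / 2)) := by
      refine Finset.sum_congr rfl fun r _ => ?_
      push_cast
      rw [show (a + i + r + 1) / 2 - (b - 1) = (a + (i + 1) + (r + 1) + 1) / 2 - b by ring,
        show (a - i + r + 1) / 2 = (a - (i + 1) + (r + 1) + 1) / 2 by ring]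
    rw [s₁] at ih₁
    rw [s₂] at ih₂
    rw [hp]
    rw [hQ] at ih₁ ⊢
    linear_combination poch (b - 1 - i) i / 2 * hc + ih₁ / 2 -
      (1 + a - 2 * b + (i + 1)) / 2 * ih₂

/-- The Chu–Vandermonde identity. -/
lemma sum_choose_mul_poch_div (N : ℕ) (b d : ℂ) (hd : ∀ n, poch d n ≠ 0) :
    ∑ n ∈ Finset.range (N + 1), (-1 : ℂ) ^ n * (N.choose n : ℂ) * (poch b n / poch d n) =
      poch (d - b) N / poch d N := by
  induction N generalizing b d with
  | zero => simp [poch_zero]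
  | succ N ih =>
    have hd0 : d ≠ 0 := by simpa [poch] using hd 1
    have hd' : ∀ n, poch (d + 1) n ≠ 0 := fun n h0 => hd (n + 1) (by
      rw [poch_succ_left, h0, mul_zero])
    have h2 : ∑ n ∈ Finset.range (N + 1), (-1 : ℂ) ^ n * (N.choose n : ℂ) *
        (poch b (n + 1) / poch d (n + 1)) = b / d * (poch (d - b) N / poch (d + 1) N) := by
      have := ih (b + 1) (d + 1) hd'
      rw [add_sub_add_right_eq_sub] at this
      rw [← this, Finset.mul_sum]
      refine Finset.sum_congr rfl fun n _ => ?_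
      rw [poch_succ_left, poch_succ_left]
      field_simp
    have h3 : poch d N * (d + N) = d * poch (d + 1) N := by rw [← poch_succ, poch_succ_left]
    have h4 := hd N
    have h5 := hd' N
    have h6 : d + N ≠ 0 := fun h0 => hd (N + 1) (by rw [poch_succ, h0, mul_zero])
    rw [sum_neg_one_pow_choose_succ, ih b d hd, h2, poch_succ, poch_succ]
    field_simp
    linear_combination -(poch (d - b) N * b) * h3

lemma sum_antidiagonal_kdfTerm (a b β d : ℂ) (hβ : ∀ n, poch β n ≠ 0)
    (hd : ∀ n, poch d n ≠ 0) (N : ℕ) :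
    ∑ p ∈ Finset.HasAntidiagonal.antidiagonal N, kdfTerm a b (d - β) β d (-1) 1 p =
      Gamma d * regTerm a b d N := by
  have hG : Gamma d ≠ 0 := Gamma_ne_zero fun m hm => hd (m + 1) (by
    rw [hm]; exact poch_neg_nat (Nat.lt_succ_self m))
  have hQ : Gamma d * (Gamma (d + N))⁻¹ = (poch d N)⁻¹ := by
    refine eq_inv_of_mul_eq_one_left ?_
    rw [mul_assoc, mul_comm _ (poch d N), ← inv_Gamma_eq_poch_mul, mul_inv_cancel₀ hG]
  have hV := sum_choose_mul_poch_div N (d - β) d hd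
  rw [sub_sub_cancel] at hV
  have hβN := hβ N
  have hdN := hd N
  have hf : (N.factorial : ℂ) ≠ 0 := by exact_mod_cast N.factorial_ne_zero
  calc ∑ p ∈ Finset.HasAntidiagonal.antidiagonal N, kdfTerm a b (d - β) β d (-1) 1 p
      = ∑ n ∈ Finset.range (N + 1), (poch a N * poch b N * (-1) ^ N / (poch β N * N.factorial)) *
          ((-1 : ℂ) ^ n * (N.choose n : ℂ) * (poch (d - β) n / poch d n)) := by
        rw [← Finset.Nat.sum_antidiagonal_swap, Finset.Nat.sum_antidiagonal_eq_sum_range_succ_mk]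
        refine Finset.sum_congr rfl fun n hn => ?_
        have hn' : n ≤ N := Nat.lt_succ_iff.1 (Finset.mem_range.1 hn)
        obtain ⟨m, rfl⟩ := Nat.exists_eq_add_of_le hn'
        have hc : ((n + m).factorial : ℂ) =
            ((n + m).choose n : ℂ) * n.factorial * m.factorial := by
          rw [← Nat.choose_mul_factorial_mul_factorial hn', Nat.add_sub_cancel_left]
          push_cast
          ring
        have hs : (-1 : ℂ) ^ n * (-1) ^ n = 1 := by rw [← mul_pow]; simp
        have hfn : (n.factorial : ℂ) ≠ 0 := by exact_mod_cast n.factorial_ne_zero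
        have hfm : (m.factorial : ℂ) ≠ 0 := by exact_mod_cast m.factorial_ne_zero
        have hch : ((n + m).choose n : ℂ) ≠ 0 := by
          exact_mod_cast (Nat.choose_pos hn').ne'
        have hdn := hd n
        simp only [kdfTerm, Prod.swap, Nat.add_sub_cancel_left, one_pow, mul_one]
        rw [add_comm m n, hc, pow_add]
        field_simp
        linear_combination -(poch a (n + m) * poch b (n + m) * poch (d - β) n) * hs
    _ = Gamma d * regTerm a b d N := by
        rw [← Finset.mul_sum, hV, regTerm]
        calc _ = (-1) ^ N * poch a N * poch b N * (poch d N)⁻¹ / (N.factorial : ℂ) := by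
              field_simp
          _ = _ := by rw [← hQ]; ring

theorem stmt_14 (i : ℕ) (α β γ : ℂ)
    (hβ : ∀ m n : ℕ, poch β (m + n) ≠ 0)
    (hd : ∀ n : ℕ, poch (α - γ + 1 + (i : ℂ)) n ≠ 0)
    (hΓ1 : notNonposInt (1 + α - γ + (i : ℂ)))
    (hΓ2 : notNonposInt (γ - (i : ℂ)))
    (hΓ3 : notNonposInt (γ))
    (hΓ4 : notNonposInt (1 + α - 2 * γ + (i : ℂ)))
    (hΓs : ∀ r : ℕ, r ≤ i →
      notNonposInt ((α + (i : ℂ) + (r : ℂ) + 1) / 2 - γ) ∧ notNonposInt ((α - (i : ℂ) + (r : ℂ) + 1) / 2))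
    (hsum : Summable fun p : ℕ × ℕ => ‖kdfTerm α γ (α - β - γ + 1 + (i : ℂ)) β (α - γ + 1 + (i : ℂ)) (-1) 1 p‖) :
    (∑' p : ℕ × ℕ, kdfTerm α γ (α - β - γ + 1 + (i : ℂ)) β (α - γ + 1 + (i : ℂ)) (-1) 1 p) =
      (2 : ℂ) ^ ((i : ℂ) - 2 * γ) * Gamma (1 + α - γ + (i : ℂ)) * Gamma (γ - (i : ℂ)) /
        (Gamma γ * Gamma (1 + α - 2 * γ + (i : ℂ))) *
      ∑ r ∈ Finset.range (i + 1), (-1 : ℂ) ^ r * (i.choose r : ℂ) *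
        Gamma ((α + (i : ℂ) + (r : ℂ) + 1) / 2 - γ) /
        Gamma ((α - (i : ℂ) + (r : ℂ) + 1) / 2) := by
  set d := α - γ + 1 + (i : ℂ) with hd_def
  rw [show α - β - γ + 1 + (i : ℂ) = d - β by rw [hd_def]; ring] at *
  have hβ' : ∀ n, poch β n ≠ 0 := fun n => by simpa using hβ 0 n
  have hdiag := sum_antidiagonal_kdfTerm α γ β d hβ' hd
  have hd1 : 1 + α - γ + (i : ℂ) = d := by rw [hd_def]; ring
  rw [hd1] at hΓ1 ⊢
  have hGd := Gamma_ne_zero hΓ1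
  have htsum : (∑' p : ℕ × ℕ, kdfTerm α γ (d - β) β d (-1) 1 p) = Gamma d * regHyp α γ d := by
    have h1 := (Finset.HasAntidiagonal.sigmaAntidiagonalEquivProd.summable_iff).2 hsum.of_norm
    rw [← Finset.HasAntidiagonal.sigmaAntidiagonalEquivProd.tsum_eq, regHyp, ← tsum_mul_left]
    refine (h1.tsum_sigma' fun n => (hasSum_fintype _).summable).trans ?_
    refine tsum_congr fun N => ?_
    rw [← hdiag N, tsum_fintype]
    exact Finset.sum_coe_sort (Finset.HasAntidiagonal.antidiagonal N) (kdfTerm α γ (d - β) β d (-1) 1)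
  have hnorm : Summable fun N => ‖regTerm α γ d N‖ := by
    have h1 := ((Finset.HasAntidiagonal.sigmaAntidiagonalEquivProd.summable_iff).2 hsum).sigma
    refine Summable.of_nonneg_of_le (fun N => norm_nonneg _) (fun N => ?_)
      (h1.mul_left ‖Gamma d‖⁻¹)
    rw [← div_eq_inv_mul, le_div_iff₀ (norm_pos_iff.2 hGd), mul_comm, ← norm_mul, ← hdiag N,
      tsum_fintype]
    refine (norm_sum_le _ _).trans_eq ?_
    exact (Finset.sum_coe_sort (Finset.HasAntidiagonal.antidiagonal N)
      fun p => ‖kdfTerm α γ (d - β) β d (-1) 1 p‖).symm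
  have hcond : 0 < (1 + i - 2 * γ).re ∨ i = 0 ∧ ∃ k : ℕ, α = -k := by
    by_cases hα : notNonposInt α
    · left
      have := re_pos_of_summable_norm_regTerm hα hΓ3 hnorm
      rwa [show d - α - γ = 1 + i - 2 * γ by rw [hd_def]; ring] at this
    · right
      obtain ⟨k, hk⟩ : ∃ k : ℕ, α = -k := by simpa [notNonposInt] using hα
      refine ⟨?_, k, hk⟩
      by_contra hi
      obtain ⟨j, rfl⟩ := Nat.exists_eq_succ_of_ne_zero hi
      rcases Nat.even_or_odd' k with ⟨l, rfl | rfl⟩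
      · refine (hΓs j (Nat.le_succ j)).2 l ?_
        rw [hk]; push_cast; ring
      · refine (hΓs (j + 1) le_rfl).2 l ?_
        rw [hk]; push_cast; ring
  have hmain := poch_mul_regHyp_eq i α γ hcond hΓ4
  rw [hd1] at hmain
  have hp := inv_Gamma_eq_poch_mul (γ - i) i
  rw [sub_add_cancel] at hp
  have hG2 := Gamma_ne_zero hΓ2
  have hG3 := Gamma_ne_zero hΓ3
  have hG4 := Gamma_ne_zero hΓ4
  rw [htsum]
  simp only [mul_div_assoc]
  have hp' : Gamma γ = poch (γ - i) i * Gamma (γ - i) := by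
    field_simp at hp
    linear_combination hp
  have hp0 : poch (γ - i) i ≠ 0 := fun h0 => hG3 (by rw [hp', h0, zero_mul])
  rw [hp']
  field_simp at hmain ⊢
  linear_combination hmain
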